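/- Let S = {ξ ∈ ℝ^m : Cξ ≤ d} and Ŝ = {ξ ∈ ℝ^m : Aξ ≤ b} with A a real L×m matrix and b ∈ ℝ^L. Let ξ̂₁,…,ξ̂_N ∈ S be samples, and suppose λ ≥ 0, s₁,…,s_N ≥ 0, and for each i ≤ N vectors θᵢ ∈ ℝ^L and γᵢ ∈ ℝ^k with θᵢ ≥ 0, γᵢ ≥ 0 satisfy: (i) 1 + ⟨θᵢ, b − Aξ̂ᵢ⟩ + ⟨γᵢ, d − Cξ̂ᵢ⟩ ≤ sᵢ and (ii) ‖Aᵀθᵢ + Cᵀγᵢ‖₂ ≤ λ. Then for every ε ≥ 0 and every choice of points ξ₁,…,ξ_N ∈ S with (1/N)Σᵢ ‖ξᵢ − ξ̂ᵢ‖₂ ≤ ε, one has (1/N)·#{i : ξᵢ ∈ Ŝ} ≤ λε + (1/N)Σᵢ sᵢ. -/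

import Mathlib

open Matrix

/-- The Euclidean (2-)norm of a vector in `ℝ^m`. -/
noncomputable def euclNorm {m : ℕ} (x : Fin m → ℝ) : ℝ :=
  Real.sqrt (∑ i, (x i) ^ 2)

lemma euclNorm_nonneg {m : ℕ} (x : Fin m → ℝ) : 0 ≤ euclNorm x :=
  Real.sqrt_nonneg _

/-- Cauchy–Schwarz for `euclNorm`. -/
lemma abs_dotProduct_le_euclNorm_mul_euclNorm {m : ℕ} (x y : Fin m → ℝ) :
    |x ⬝ᵥ y| ≤ euclNorm x * euclNorm y := by
  rw [euclNorm, euclNorm, ← Real.sqrt_mul (Finset.sum_nonneg fun i _ => sq_nonneg (x i))]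
  exact Real.abs_le_sqrt (Finset.sum_mul_sq_le_sq_mul_sq Finset.univ x y)

/-- Weak duality for a single sample: a feasible dual pair bounds from below the cost of moving
`y` to a point `x` satisfying both systems of inequalities. -/
lemma one_le_mul_euclNorm_sub_add {m k L : ℕ}
    {C : Matrix (Fin k) (Fin m) ℝ} {d : Fin k → ℝ}
    {A : Matrix (Fin L) (Fin m) ℝ} {b : Fin L → ℝ} {x y : Fin m → ℝ} {lam s : ℝ}
    {θ : Fin L → ℝ} (hθ : ∀ l, 0 ≤ θ l) {γ : Fin k → ℝ} (hγ : ∀ j, 0 ≤ γ j)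
    (hcon : 1 + θ ⬝ᵥ (b - A.mulVec y) + γ ⬝ᵥ (d - C.mulVec y) ≤ s)
    (hdual : euclNorm (A.transpose.mulVec θ + C.transpose.mulVec γ) ≤ lam)
    (hC : ∀ j, C.mulVec x j ≤ d j) (hA : ∀ l, A.mulVec x l ≤ b l) :
    1 ≤ lam * euclNorm (x - y) + s := by
  have hA' : 0 ≤ θ ⬝ᵥ (b - A.mulVec x) :=
    Finset.sum_nonneg fun l _ => mul_nonneg (hθ l) (sub_nonneg.2 (hA l))
  have hC' : 0 ≤ γ ⬝ᵥ (d - C.mulVec x) :=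
    Finset.sum_nonneg fun j _ => mul_nonneg (hγ j) (sub_nonneg.2 (hC j))
  have hpair : (A.transpose.mulVec θ + C.transpose.mulVec γ) ⬝ᵥ (x - y) =
      θ ⬝ᵥ A.mulVec x - θ ⬝ᵥ A.mulVec y + (γ ⬝ᵥ C.mulVec x - γ ⬝ᵥ C.mulVec y) := by
    simp only [add_dotProduct, mulVec_transpose, ← dotProduct_mulVec, dotProduct_sub]
    ring
  have hcs := neg_le_of_abs_le (abs_dotProduct_le_euclNorm_mul_euclNorm
    (A.transpose.mulVec θ + C.transpose.mulVec γ) (x - y))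
  have hle := mul_le_mul_of_nonneg_right hdual (euclNorm_nonneg (x - y))
  simp only [dotProduct_sub] at hA' hC' hcon
  linarith

open Classical in
/-- Weak-duality upper bound of the finite-program reformulation of the
best-case probability of being safe: if the dual feasibility conditions hold,
then for every Wasserstein-`ε` transport `ξ` of the samples `ξ̂` supported on
`S = {ξ | Cξ ≤ d}`, the fraction of transported points lying inside the closed
safety polytope `Ŝ = {ξ | Aξ ≤ b}` is at most `λε + (1/N) ∑ᵢ sᵢ`. -/
theorem best_case_finite_program_upper_bound {m k L N : ℕ}
    (C : Matrix (Fin k) (Fin m) ℝ) (d : Fin k → ℝ)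
    (A : Matrix (Fin L) (Fin m) ℝ) (b : Fin L → ℝ)
    (ξhat : Fin N → Fin m → ℝ) (hξhat : ∀ i j, C.mulVec (ξhat i) j ≤ d j)
    (lam : ℝ) (hlam : 0 ≤ lam) (s : Fin N → ℝ) (hs : ∀ i, 0 ≤ s i)
    (θ : Fin N → Fin L → ℝ) (hθ : ∀ i l, 0 ≤ θ i l)
    (γ : Fin N → Fin k → ℝ) (hγ : ∀ i j, 0 ≤ γ i j)
    (hcon : ∀ i,
      1 + θ i ⬝ᵥ (b - A.mulVec (ξhat i)) + γ i ⬝ᵥ (d - C.mulVec (ξhat i)) ≤ s i)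
    (hdual : ∀ i, euclNorm (A.transpose.mulVec (θ i) + C.transpose.mulVec (γ i)) ≤ lam) :
    ∀ ε : ℝ, 0 ≤ ε → ∀ ξ : Fin N → Fin m → ℝ,
      (∀ i j, C.mulVec (ξ i) j ≤ d j) →
      (1 / (N : ℝ)) * ∑ i, euclNorm (ξ i - ξhat i) ≤ ε →
      (1 / (N : ℝ)) *
          ((Finset.univ.filter (fun i : Fin N => ∀ l, A.mulVec (ξ i) l ≤ b l)).card : ℝ) ≤
        lam * ε + (1 / (N : ℝ)) * ∑ i, s i := by
  intro ε _ ξ hξ hε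
  have hcard : ((Finset.univ.filter (fun i : Fin N => ∀ l, A.mulVec (ξ i) l ≤ b l)).card : ℝ) ≤
      lam * ∑ i, euclNorm (ξ i - ξhat i) + ∑ i, s i := by
    rw [← Finset.sum_boole, Finset.mul_sum, ← Finset.sum_add_distrib]
    refine Finset.sum_le_sum fun i _ => ?_
    split_ifs with hi
    · exact one_le_mul_euclNorm_sub_add (hθ i) (hγ i) (hcon i) (hdual i) (hξ i) hi
    · exact add_nonneg (mul_nonneg hlam (euclNorm_nonneg _)) (hs i)
  calc _ ≤ (1 / (N : ℝ)) * (lam * ∑ i, euclNorm (ξ i - ξhat i) + ∑ i, s i) :=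
        mul_le_mul_of_nonneg_left hcard (by positivity)
    _ = lam * ((1 / (N : ℝ)) * ∑ i, euclNorm (ξ i - ξhat i)) + (1 / (N : ℝ)) * ∑ i, s i := by
        ring
    _ ≤ _ := by gcongr
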